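/- Let Y be a Banach space, A, B bounded linear operators on Y, 1 < α < 2, 0 < β < 1, η, η̂ ∈ Y, and let g : [0,∞) → Y be continuous. Define x(t) = η + ( ∑_{k,m≥0} Q_{k,m}^{A,B} B · t^{k(α−β)+mα+α} / Γ(k(α−β)+mα+α+1) ) η + ( ∑_{k,m≥0} Q_{k,m}^{A,B} · t^{k(α−β)+mα+1} / Γ(k(α−β)+mα+2) ) η̂ + ∫₀ᵗ [ ∑_{k,m≥0} Q_{k,m}^{A,B} (t−s)^{k(α−β)+mα+α−1} / Γ(k(α−β)+mα+α) ] g(s) ds. Then x(0) = η, x is differentiable with x′(0) = η̂, the Caputo fractional derivatives (ᶜD^{α}x)(t) and (ᶜD^{β}x)(t) exist for every t > 0, and x satisfies the multi-term fractional evolution equation (ᶜD^{α}x)(t) − A(ᶜD^{β}x)(t) = B x(t) + g(t) for all t > 0. -/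

import Mathlib

open MeasureTheory

/-- The operators `Q_{k,m}^{A,B}` from the paper: `Q k 0 = A^k`, `Q 0 m = B^m`, and
`Q k m = ∑_{l=0}^{k} A^{k-l} B Q l (m-1)` for `m ≥ 1`. -/
noncomputable def Q {𝔸 : Type*} [Ring 𝔸] (A B : 𝔸) : ℕ → ℕ → 𝔸
  | k, 0 => A ^ k
  | k, m + 1 => ∑ l ∈ Finset.range (k + 1), A ^ (k - l) * B * Q A B l m

set_option autoImplicit false

section aux
open Set

/-- The truncated power kernel. -/
noncomputable def pk (b u : ℝ) : ℝ := if 0 < u then u ^ (b - 1) else 0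

lemma pk_measurable (b : ℝ) : Measurable (pk b) := by
  unfold pk
  exact Measurable.ite measurableSet_Ioi (by fun_prop) measurable_const

lemma pk_nonneg (b u : ℝ) : 0 ≤ pk b u := by
  unfold pk; split_ifs with h
  · positivity
  · exact le_rfl

lemma beta_real (a b r : ℝ) (ha : 0 < a) (hb : 0 < b) (hr : 0 < r) :
    ∫ x in (0:ℝ)..r, x ^ (a - 1) * (r - x) ^ (b - 1)
      = r ^ (a + b - 1) * (Real.Gamma a * Real.Gamma b / Real.Gamma (a + b)) := by
  have h := Complex.betaIntegral_scaled a b hr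
  rw [Complex.betaIntegral_eq_Gamma_mul_div _ _ (by simpa) (by simpa)] at h
  have h2 : ∫ x in (0:ℝ)..r, (x:ℂ) ^ ((a:ℂ) - 1) * ((r:ℂ) - x) ^ ((b:ℂ) - 1)
      = ∫ x in (0:ℝ)..r, ((x ^ (a - 1) * (r - x) ^ (b - 1) : ℝ) : ℂ) := by
    apply intervalIntegral.integral_congr
    intro x hx
    rw [uIcc_of_le hr.le] at hx
    simp only
    rw [Complex.ofReal_mul, Complex.ofReal_cpow hx.1, Complex.ofReal_cpow (sub_nonneg.2 hx.2)]
    push_cast; rfl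
  rw [h2, intervalIntegral.integral_ofReal] at h
  rw [← Complex.ofReal_add, Complex.Gamma_ofReal, Complex.Gamma_ofReal, Complex.Gamma_ofReal] at h
  have h3 : ((r:ℂ)) ^ (((a + b : ℝ) : ℂ) - 1) = ((r ^ (a + b - 1) : ℝ) : ℂ) := by
    rw [Complex.ofReal_cpow hr.le]; push_cast; rfl
  rw [h3] at h
  exact_mod_cast h

lemma beta_shift (a b s t : ℝ) (ha : 0 < a) (hb : 0 < b) (hst : s < t) :
    ∫ τ in s..t, (t - τ) ^ (a - 1) * (τ - s) ^ (b - 1)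
      = (t - s) ^ (a + b - 1) * (Real.Gamma a * Real.Gamma b / Real.Gamma (a + b)) := by
  rw [← beta_real a b (t - s) ha hb (by linarith)]
  have := intervalIntegral.integral_comp_sub_left
    (a := s) (b := t) (fun x => x ^ (a - 1) * (t - s - x) ^ (b - 1)) t
  simp only [sub_self] at this
  rw [← this]
  apply intervalIntegral.integral_congr
  intro x _
  simp only
  congr 2; ring

lemma beta_shift_integrable (a b s t : ℝ) (ha : 0 < a) (hb : 0 < b) (hst : s < t) :
    IntervalIntegrable (fun τ => (t - τ) ^ (a - 1) * (τ - s) ^ (b - 1)) volume s t := by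
  by_contra h
  have h1 := intervalIntegral.integral_undef h
  rw [beta_shift a b s t ha hb hst] at h1
  have := Real.Gamma_pos_of_pos ha
  have := Real.Gamma_pos_of_pos hb
  have := Real.Gamma_pos_of_pos (add_pos ha hb)
  have := Real.rpow_pos_of_pos (sub_pos.2 hst) (a + b - 1)
  have : 0 < (t - s) ^ (a + b - 1) * (Real.Gamma a * Real.Gamma b / Real.Gamma (a + b)) := by
    positivity
  linarith

lemma pk_prod_eq (a b s t : ℝ) (hs : 0 < s) :
    (Ioc (0:ℝ) t).indicator (fun τ => pk a (t - τ) * pk b (τ - s))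
      = (Ioo s t).indicator (fun τ => (t - τ) ^ (a - 1) * (τ - s) ^ (b - 1)) := by
  ext τ
  simp only [indicator, pk, mem_Ioc, mem_Ioo, sub_pos]
  by_cases h1 : s < τ <;> by_cases h2 : τ < t
  · have : 0 < τ := by linarith
    simp [h1, h2, this, h2.le]
  all_goals simp [h1, h2]

lemma pk_prod_integrable (a b s t : ℝ) (ha : 0 < a) (hb : 0 < b) (hs : 0 < s) (hst : s < t) :
    IntegrableOn (fun τ => pk a (t - τ) * pk b (τ - s)) (Ioc 0 t) := by
  rw [← integrable_indicator_iff measurableSet_Ioc, pk_prod_eq a b s t hs,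
    integrable_indicator_iff measurableSet_Ioo]
  have := beta_shift_integrable a b s t ha hb hst
  rw [intervalIntegrable_iff_integrableOn_Ioo_of_le hst.le] at this
  exact this

lemma pk_prod_integral (a b s t : ℝ) (ha : 0 < a) (hb : 0 < b) (hs : 0 < s) (hst : s < t) :
    ∫ τ in Ioc 0 t, pk a (t - τ) * pk b (τ - s)
      = (t - s) ^ (a + b - 1) * (Real.Gamma a * Real.Gamma b / Real.Gamma (a + b)) := by
  rw [← integral_indicator measurableSet_Ioc, pk_prod_eq a b s t hs,
    integral_indicator measurableSet_Ioo, ← beta_shift a b s t ha hb hst,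
    intervalIntegral.integral_of_le hst.le, integral_Ioc_eq_integral_Ioo]

variable {Y : Type*} [NormedAddCommGroup Y] [NormedSpace ℝ Y]

/-- Riemann–Liouville fractional integral. -/
noncomputable def J (a : ℝ) (f : ℝ → Y) (t : ℝ) : Y :=
  (Real.Gamma a)⁻¹ • ∫ s in (0:ℝ)..t, ((t - s) ^ (a - 1)) • f s

lemma ker_integrable (a t : ℝ) (ha : 0 < a) :
    IntervalIntegrable (fun s => (t - s) ^ (a - 1)) volume 0 t := by
  have h := intervalIntegral.intervalIntegrable_rpow' (a := t) (b := 0) (r := a - 1) (by linarith)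
  have := h.comp_sub_left t
  simpa using this

lemma ker_integral (a t : ℝ) (ha : 0 < a) :
    ∫ s in (0:ℝ)..t, (t - s) ^ (a - 1) = t ^ a / a := by
  have := intervalIntegral.integral_comp_sub_left (a := 0) (b := t)
    (fun x : ℝ => x ^ (a - 1)) t
  simp only [sub_self, sub_zero] at this
  rw [this, integral_rpow (Or.inl (by linarith))]
  simp [Real.zero_rpow ha.ne']

lemma J_integrable {f : ℝ → Y} (hf : ContinuousOn f (Ici 0)) {a t : ℝ} (ha : 0 < a)
    (ht : 0 ≤ t) : IntervalIntegrable (fun s => ((t - s) ^ (a - 1)) • f s) volume 0 t := by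
  apply (ker_integrable a t ha).smul_continuousOn
  rw [uIcc_of_le ht]
  exact hf.mono Icc_subset_Ici_self

lemma J_congr {f g : ℝ → Y} {a t : ℝ} (ht : 0 ≤ t) (h : ∀ s, 0 ≤ s → f s = g s) :
    J a f t = J a g t := by
  unfold J
  congr 1
  apply intervalIntegral.integral_congr
  intro s hs
  rw [uIcc_of_le ht] at hs
  simp only [h s hs.1]

lemma J_add {f g : ℝ → Y} (hf : ContinuousOn f (Ici 0)) (hg : ContinuousOn g (Ici 0))
    {a t : ℝ} (ha : 0 < a) (ht : 0 ≤ t) :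
    J a (fun s => f s + g s) t = J a f t + J a g t := by
  unfold J
  simp only [smul_add]
  rw [intervalIntegral.integral_add (J_integrable hf ha ht) (J_integrable hg ha ht), smul_add]

lemma J_clm [CompleteSpace Y] (A : Y →L[ℝ] Y) {f : ℝ → Y} (hf : ContinuousOn f (Ici 0))
    {a t : ℝ} (ha : 0 < a) (ht : 0 ≤ t) :
    J a (fun s => A (f s)) t = A (J a f t) := by
  unfold J
  rw [map_smul, ← ContinuousLinearMap.intervalIntegral_comp_comm A (J_integrable hf ha ht)]
  simp only [map_smul]

lemma J_const [CompleteSpace Y] (v : Y) {a t : ℝ} (ha : 0 < a) :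
    J a (fun _ => v) t = (t ^ a / Real.Gamma (a + 1)) • v := by
  unfold J
  rw [intervalIntegral.integral_smul_const, ker_integral a t ha, smul_smul,
    Real.Gamma_add_one ha.ne']
  congr 1
  have := (Real.Gamma_pos_of_pos ha).ne'
  field_simp

lemma J_norm_le {f : ℝ → Y} {a t M : ℝ} (ha : 0 < a) (ht : 0 ≤ t)
    (hM : ∀ s ∈ Icc 0 t, ‖f s‖ ≤ M) : ‖J a f t‖ ≤ t ^ a / Real.Gamma (a + 1) * M := by
  unfold J
  have hG := Real.Gamma_pos_of_pos ha
  rw [norm_smul, norm_inv, Real.norm_of_nonneg hG.le]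
  have : ‖∫ s in (0:ℝ)..t, ((t - s) ^ (a - 1)) • f s‖ ≤ ∫ s in (0:ℝ)..t, (t - s) ^ (a - 1) * M := by
    apply intervalIntegral.norm_integral_le_of_norm_le ht
    · refine Filter.Eventually.of_forall fun s hs => ?_
      rw [norm_smul, Real.norm_of_nonneg (Real.rpow_nonneg (by linarith [hs.2]) _)]
      exact mul_le_mul_of_nonneg_left (hM s ⟨hs.1.le, hs.2⟩)
        (Real.rpow_nonneg (by linarith [hs.2]) _)
    · exact (ker_integrable a t ha).mul_const M
  rw [intervalIntegral.integral_mul_const, ker_integral a t ha] at this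
  calc _ ≤ (Real.Gamma a)⁻¹ * (t ^ a / a * M) := by gcongr
    _ = _ := by
      rw [Real.Gamma_add_one ha.ne']
      field_simp

lemma J_one {f : ℝ → Y} (t : ℝ) : J 1 f t = ∫ s in (0:ℝ)..t, f s := by
  simp [J]

lemma ext_cont {f : ℝ → Y} (hf : ContinuousOn f (Ici 0)) :
    Continuous (fun s => f (max s 0)) :=
  hf.comp_continuous (by fun_prop) (fun s => mem_Ici.2 (le_max_right _ _))

lemma J_one_deriv [CompleteSpace Y] {f : ℝ → Y} (hf : ContinuousOn f (Ici 0)) {t : ℝ}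
    (ht : 0 ≤ t) : HasDerivWithinAt (J 1 f) (f t) (Ici 0) t := by
  have hc := ext_cont hf
  have h := (hc.integral_hasStrictDerivAt 0 t).hasDerivAt.hasDerivWithinAt (s := Ici 0)
  simp only [max_eq_left ht] at h
  apply h.congr_of_mem _ ht
  intro s hs
  rw [J_one]
  apply intervalIntegral.integral_congr
  intro r hr
  rw [uIcc_of_le hs] at hr
  simp [max_eq_left hr.1]

lemma J_scaled {f : ℝ → Y} {a t : ℝ} (ha : 0 < a) (ht : 0 ≤ t) :
    J a f t = (t ^ a * (Real.Gamma a)⁻¹) • ∫ u in (0:ℝ)..1, ((1 - u) ^ (a - 1)) • f (max (t * u) 0) := by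
  rcases ht.eq_or_lt with rfl | ht
  · simp [J, Real.zero_rpow ha.ne']
  unfold J
  rw [mul_comm, mul_smul]
  congr 1
  have h := intervalIntegral.smul_integral_comp_mul_left (a := 0) (b := 1)
    (fun s => ((t - s) ^ (a - 1)) • f s) t
  simp only [mul_zero, mul_one] at h
  rw [← h]
  have : t ^ a = t * t ^ (a - 1) := by
    rw [Real.rpow_sub_one ht.ne']; field_simp
  rw [this, mul_smul]
  congr 1
  rw [← intervalIntegral.integral_smul]
  apply intervalIntegral.integral_congr
  intro u hu
  rw [uIcc_of_le zero_le_one] at hu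
  simp only
  rw [max_eq_left (by have := hu.1; positivity), smul_smul, ← Real.mul_rpow ht.le (by linarith [hu.2])]
  congr 2; ring

lemma J_cont {f : ℝ → Y} (hf : ContinuousOn f (Ici 0)) {a : ℝ} (ha : 0 < a) :
    ContinuousOn (J a f) (Ici 0) := by
  have hc := ext_cont hf
  refine ContinuousOn.congr (f := fun t => (t ^ a * (Real.Gamma a)⁻¹) •
    ∫ u in (0:ℝ)..1, ((1 - u) ^ (a - 1)) • f (max (t * u) 0)) ?_ (fun t ht => J_scaled ha ht)
  apply Continuous.continuousOn
  apply Continuous.smul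
  · exact (Real.continuous_rpow_const ha.le).mul continuous_const
  rw [continuous_iff_continuousAt]
  intro t0
  obtain ⟨M, hM⟩ := (isCompact_Icc (a := -(|t0| + 1)) (b := |t0| + 1)).exists_bound_of_continuousOn
    hc.continuousOn
  have hmeas : AEStronglyMeasurable (fun u : ℝ => (1 - u) ^ (a - 1))
      (volume.restrict (uIoc (0:ℝ) 1)) := by
    have : Measurable (fun u : ℝ => (1 - u) ^ (a - 1)) := by fun_prop
    exact this.aestronglyMeasurable
  apply intervalIntegral.continuousAt_of_dominated_interval
    (bound := fun u => (1 - u) ^ (a - 1) * M)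
  · refine Filter.Eventually.of_forall fun t => hmeas.smul ?_
    exact (hc.comp (continuous_const_mul t)).aestronglyMeasurable
  · filter_upwards [Metric.ball_mem_nhds t0 one_pos] with t ht
    refine Filter.Eventually.of_forall fun u hu => ?_
    rw [uIoc_of_le zero_le_one] at hu
    rw [norm_smul, Real.norm_of_nonneg (Real.rpow_nonneg (by linarith [hu.2]) _)]
    refine mul_le_mul_of_nonneg_left (hM (t * u) ?_) (Real.rpow_nonneg (by linarith [hu.2]) _)
    rw [Metric.mem_ball, Real.dist_eq] at ht
    have h1 : |t| ≤ |t0| + 1 := by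
      have := abs_sub_abs_le_abs_sub t t0
      linarith
    have h2 : |t * u| ≤ |t0| + 1 := by
      rw [abs_mul, abs_of_pos hu.1]
      nlinarith [abs_nonneg t, hu.1, hu.2]
    exact abs_le.1 h2
  · exact (ker_integrable a 1 ha).mul_const M
  · refine Filter.Eventually.of_forall fun u hu => ?_
    have : Continuous fun t => f (max (t * u) 0) := hc.comp (continuous_mul_const u)
    exact (this.const_smul _).continuousAt

lemma pk_inner {f : ℝ → Y} (b t τ : ℝ) (hτ : τ ∈ Ioc 0 t) :
    ∫ s in (0:ℝ)..τ, ((τ - s) ^ (b - 1)) • f s = ∫ s in Ioc 0 t, pk b (τ - s) • f s := by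
  rw [intervalIntegral.integral_of_le hτ.1.le, integral_Ioc_eq_integral_Ioo,
    ← integral_indicator measurableSet_Ioo, ← integral_indicator measurableSet_Ioc]
  congr 1
  ext s
  simp only [indicator, pk, mem_Ioc, mem_Ioo, sub_pos]
  by_cases h1 : 0 < s <;> by_cases h2 : s < τ
  · simp [h1, h2, h2.le.trans hτ.2]
  all_goals simp [h1, h2]

lemma J_semigroup [CompleteSpace Y] {f : ℝ → Y} (hf : ContinuousOn f (Ici 0)) {a b t : ℝ}
    (ha : 0 < a) (hb : 0 < b) (ht : 0 ≤ t) : J a (J b f) t = J (a + b) f t := by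
  rcases ht.eq_or_lt with rfl | ht
  · simp [J]
  have hc := ext_cont hf
  obtain ⟨M, hM⟩ := (isCompact_Icc (a := (0:ℝ)) (b := t)).exists_bound_of_continuousOn
    (hf.mono Icc_subset_Ici_self)
  have hA : AEStronglyMeasurable f (volume.restrict (Ioc 0 t)) :=
    (hf.mono (Ioc_subset_Icc_self.trans Icc_subset_Ici_self)).aestronglyMeasurable measurableSet_Ioc
  have hae : ∀ᵐ s ∂(volume.restrict (Ioc (0:ℝ) t)), 0 < s ∧ s < t := by
    rw [← restrict_Ioo_eq_restrict_Ioc]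
    filter_upwards [ae_restrict_mem measurableSet_Ioo] with s hs using hs
  have hK : Measurable (fun p : ℝ × ℝ => pk a (t - p.1) * pk b (p.1 - p.2)) :=
    ((pk_measurable a).comp (by fun_prop)).mul ((pk_measurable b).comp (by fun_prop))
  have hG : AEStronglyMeasurable
      (Function.uncurry fun τ s => (pk a (t - τ) * pk b (τ - s)) • f s)
      ((volume.restrict (Ioc 0 t)).prod (volume.restrict (Ioc 0 t))) :=
    hK.aestronglyMeasurable.smul hA.comp_snd
  have hint : Integrable (Function.uncurry fun τ s => (pk a (t - τ) * pk b (τ - s)) • f s)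
      ((volume.restrict (Ioc 0 t)).prod (volume.restrict (Ioc 0 t))) := by
    rw [integrable_prod_iff' hG]
    constructor
    · filter_upwards [hae] with s hs
      exact (pk_prod_integrable a b s t ha hb hs.1 hs.2).smul_const (f s)
    · have hi : Integrable (fun s => ((t - s) ^ (a + b - 1)) *
          (Real.Gamma a * Real.Gamma b / Real.Gamma (a + b)) * ‖f s‖)
          (volume.restrict (Ioc 0 t)) := by
        have h1 := (J_integrable hf.norm (add_pos ha hb) ht.le).const_mul
          (Real.Gamma a * Real.Gamma b / Real.Gamma (a + b))
        rw [intervalIntegrable_iff_integrableOn_Ioc_of_le ht.le] at h1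
        refine Integrable.congr h1 (Filter.Eventually.of_forall fun s => ?_)
        simp only [smul_eq_mul]; ring
      refine hi.congr ?_
      filter_upwards [hae] with s hs
      rw [← pk_prod_integral a b s t ha hb hs.1 hs.2, ← integral_mul_const]
      congr 1
      ext τ
      simp only [Function.uncurry]
      rw [norm_smul, Real.norm_of_nonneg (mul_nonneg (pk_nonneg _ _) (pk_nonneg _ _))]
  have hswap := integral_integral_swap hint
  have hL : ∫ τ in Ioc 0 t, ∫ s in Ioc 0 t, (pk a (t - τ) * pk b (τ - s)) • f s
      = ∫ τ in (0:ℝ)..t, ((t - τ) ^ (a - 1)) • ∫ s in (0:ℝ)..τ, ((τ - s) ^ (b - 1)) • f s := by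
    rw [intervalIntegral.integral_of_le ht.le]
    apply integral_congr_ae
    filter_upwards [hae] with τ hτ
    rw [pk_inner b t τ ⟨hτ.1, hτ.2.le⟩, ← integral_smul]
    congr 1
    ext s
    rw [mul_smul]
    congr 1
    simp [pk, hτ.2]
  have hR : ∫ s in Ioc 0 t, ∫ τ in Ioc 0 t, (pk a (t - τ) * pk b (τ - s)) • f s
      = ∫ s in (0:ℝ)..t, (Real.Gamma a * Real.Gamma b / Real.Gamma (a + b)) •
          ((t - s) ^ (a + b - 1)) • f s := by
    rw [intervalIntegral.integral_of_le ht.le]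
    apply integral_congr_ae
    filter_upwards [hae] with s hs
    rw [integral_smul_const, pk_prod_integral a b s t ha hb hs.1 hs.2, mul_comm, mul_smul]
  rw [hL, hR, intervalIntegral.integral_smul] at hswap
  have h1 := (Real.Gamma_pos_of_pos ha).ne'
  have h2 := (Real.Gamma_pos_of_pos hb).ne'
  have h3 := (Real.Gamma_pos_of_pos (add_pos ha hb)).ne'
  unfold J
  simp only [smul_comm _ (Real.Gamma b)⁻¹, intervalIntegral.integral_smul]
  rw [hswap, smul_smul, smul_smul]
  congr 1
  field_simp

lemma gamma_lower (c L : ℝ) (hc : 0 ≤ c) (hL : 0 ≤ L) :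
    L ^ c * Real.exp (-L) ≤ Real.Gamma (c + 1) := by
  rw [Real.Gamma_eq_integral (by linarith), ← integral_exp_neg_Ioi, ← integral_const_mul]
  have hi := Real.GammaIntegral_convergent (s := c + 1) (by linarith)
  calc ∫ x in Ioi L, L ^ c * Real.exp (-x)
      ≤ ∫ x in Ioi L, Real.exp (-x) * x ^ (c + 1 - 1) := by
        apply setIntegral_mono_on
        · exact (integrableOn_exp_neg_Ioi L).const_mul _
        · exact hi.mono_set (Ioi_subset_Ioi hL)
        · exact measurableSet_Ioi
        · intro x hx
          rw [mul_comm, add_sub_cancel_right]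
          have : L ≤ x := le_of_lt hx
          gcongr
    _ ≤ _ := by
        apply setIntegral_mono_set hi
        · filter_upwards [ae_restrict_mem measurableSet_Ioi] with x hx
          have : 0 < x := hx
          simp only [Pi.zero_apply]
          positivity
        · exact (Ioi_subset_Ioi hL).eventuallyLE

lemma series_summable (δ α ν T D : ℝ) (hδ : 0 < δ) (hα : δ ≤ α) (hν : 0 ≤ ν) (hT : 0 < T)
    (hD : 1 ≤ D) :
    Summable fun p : ℕ × ℕ => T ^ ((p.1 : ℝ) * δ + (p.2 : ℝ) * α + ν) /
      Real.Gamma ((p.1 : ℝ) * δ + (p.2 : ℝ) * α + ν + 1) * D ^ (p.1 + p.2) := by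
  obtain ⟨ε, hε0, hε1, hε⟩ : ∃ ε : ℝ, 0 < ε ∧ ε ≤ 1 ∧ ε ^ δ = (2 * D)⁻¹ := by
    refine ⟨((2 * D)⁻¹) ^ (δ⁻¹), by positivity, ?_, ?_⟩
    · apply Real.rpow_le_one (by positivity) _ (by positivity)
      exact inv_le_one_of_one_le₀ (by linarith)
    · rw [← Real.rpow_mul (by positivity), inv_mul_cancel₀ hδ.ne', Real.rpow_one]
  set L := T / ε with hL
  have hL0 : 0 < L := by positivity
  have hTL : T = ε * L := by rw [hL]; field_simp
  have hg : Summable fun p : ℕ × ℕ => (Real.exp L * ε ^ ν) * ((1 / 2 : ℝ) ^ p.1 * (1 / 2 : ℝ) ^ p.2) := by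
    apply Summable.mul_left
    exact summable_geometric_two.mul_of_nonneg summable_geometric_two
      (fun n => by positivity) (fun n => by positivity)
  have hc : ∀ p : ℕ × ℕ, 0 ≤ (p.1 : ℝ) * δ + (p.2 : ℝ) * α + ν := fun p => by
    have : 0 ≤ α := by linarith
    positivity
  refine Summable.of_nonneg_of_le (fun p => ?_) (fun p => ?_) hg
  · have := Real.Gamma_pos_of_pos (show 0 < (p.1 : ℝ) * δ + (p.2 : ℝ) * α + ν + 1 by linarith [hc p])
    positivity
  · set c := (p.1 : ℝ) * δ + (p.2 : ℝ) * α + ν with hcdef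
    have hG := gamma_lower c L (hc p) hL0.le
    have h1 : T ^ c / Real.Gamma (c + 1) ≤ Real.exp L * ε ^ c := by
      rw [div_le_iff₀ (Real.Gamma_pos_of_pos (by linarith [hc p])), hTL,
        Real.mul_rpow hε0.le hL0.le]
      calc ε ^ c * L ^ c = Real.exp L * ε ^ c * (L ^ c * Real.exp (-L)) := by
            rw [Real.exp_neg]; field_simp
        _ ≤ _ := by gcongr
    have h2 : ε ^ c ≤ ((2 * D)⁻¹) ^ (p.1 + p.2) * ε ^ ν := by
      rw [← hε, ← Real.rpow_natCast, ← Real.rpow_mul hε0.le, ← Real.rpow_add hε0]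
      apply Real.rpow_le_rpow_of_exponent_ge hε0 hε1
      rw [hcdef]; push_cast
      have : (p.2 : ℝ) * δ ≤ p.2 * α := by gcongr
      nlinarith
    calc T ^ c / Real.Gamma (c + 1) * D ^ (p.1 + p.2)
        ≤ (Real.exp L * (((2 * D)⁻¹) ^ (p.1 + p.2) * ε ^ ν)) * D ^ (p.1 + p.2) := by
          have : 0 < D := by linarith
          gcongr
          exact h1.trans (by gcongr)
      _ = _ := by
          have : D ≠ 0 := by linarith
          rw [← pow_add, mul_inv, mul_pow, inv_pow D]
          field_simp

lemma Q_succ_zero {R : Type*} [Ring R] (A B : R) (k : ℕ) : Q A B (k + 1) 0 = A * Q A B k 0 := by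
  simp [Q, pow_succ']

lemma Q_zero_succ {R : Type*} [Ring R] (A B : R) (m : ℕ) : Q A B 0 (m + 1) = B * Q A B 0 m := by
  simp [Q]

lemma Q_succ_succ {R : Type*} [Ring R] (A B : R) (k m : ℕ) :
    Q A B (k + 1) (m + 1) = A * Q A B k (m + 1) + B * Q A B (k + 1) m := by
  rw [Q, Finset.sum_range_succ]
  simp only [Nat.sub_self, pow_zero, one_mul, Q]
  rw [Finset.mul_sum]
  congr 1
  apply Finset.sum_congr rfl
  intro l hl
  rw [Finset.mem_range] at hl
  rw [show k + 1 - l = (k - l) + 1 by omega, pow_succ']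
  simp only [mul_assoc]

lemma Q_norm (A B : Y →L[ℝ] Y) : ∀ n k m : ℕ, k + m = n →
    ‖Q A B k m‖ ≤ (‖A‖ + ‖B‖ + 1) ^ n := by
  intro n
  induction n with
  | zero =>
    intro k m h
    obtain ⟨rfl, rfl⟩ : k = 0 ∧ m = 0 := by omega
    simp only [Q, pow_zero]
    exact ContinuousLinearMap.norm_id_le
  | succ n ih =>
    have key : ∀ U V : Y →L[ℝ] Y, ‖U‖ ≤ (‖A‖ + ‖B‖ + 1) ^ n → ‖V‖ ≤ (‖A‖ + ‖B‖ + 1) ^ n →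
        ‖A * U + B * V‖ ≤ (‖A‖ + ‖B‖ + 1) ^ (n + 1) := by
      intro U V hU hV
      calc ‖A * U + B * V‖ ≤ ‖A‖ * ‖U‖ + ‖B‖ * ‖V‖ :=
            (norm_add_le _ _).trans (add_le_add (norm_mul_le _ _) (norm_mul_le _ _))
        _ ≤ ‖A‖ * (‖A‖ + ‖B‖ + 1) ^ n + ‖B‖ * (‖A‖ + ‖B‖ + 1) ^ n := by gcongr
        _ ≤ _ := by
            rw [pow_succ]
            have : 0 ≤ (‖A‖ + ‖B‖ + 1) ^ n := by positivity
            nlinarith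
    have h0 : ‖(0 : Y →L[ℝ] Y)‖ ≤ (‖A‖ + ‖B‖ + 1) ^ n := by rw [norm_zero]; positivity
    intro k m h
    match k, m with
    | 0, 0 => omega
    | k + 1, 0 =>
      have := key (Q A B k 0) 0 (ih k 0 (by omega)) h0
      rw [Q_succ_zero]; simpa using this
    | 0, m + 1 =>
      have := key 0 (Q A B 0 m) h0 (ih 0 m (by omega))
      rw [Q_zero_succ]; simpa using this
    | k + 1, m + 1 =>
      rw [Q_succ_succ]
      exact key _ _ (ih k (m + 1) (by omega)) (ih (k + 1) m (by omega))

/-- locally uniformly dominated families -/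
def LocDom (F : ℕ × ℕ → ℝ → Y) : Prop :=
  (∀ p, ContinuousOn (F p) (Ici 0)) ∧
  ∀ T : ℝ, 0 < T → ∃ u : ℕ × ℕ → ℝ, Summable u ∧ ∀ p, ∀ t ∈ Icc 0 T, ‖F p t‖ ≤ u p

lemma LocDom.summable [CompleteSpace Y] {F : ℕ × ℕ → ℝ → Y} (h : LocDom F) {t : ℝ} (ht : 0 ≤ t) :
    Summable fun p => F p t := by
  obtain ⟨u, hu, hb⟩ := h.2 (t + 1) (by linarith)
  exact Summable.of_norm_bounded hu fun p => hb p t ⟨ht, by linarith⟩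

lemma LocDom.cont [CompleteSpace Y] {F : ℕ × ℕ → ℝ → Y} (h : LocDom F) :
    ContinuousOn (fun t => ∑' p, F p t) (Ici 0) := by
  intro t ht
  have ht : 0 ≤ t := ht
  obtain ⟨u, hu, hb⟩ := h.2 (t + 1) (by linarith)
  have h1 : ContinuousOn (fun t => ∑' p, F p t) (Icc 0 (t + 1)) :=
    continuousOn_tsum (fun p => (h.1 p).mono Icc_subset_Ici_self) hu hb
  have h2 := h1 t ⟨ht, by linarith⟩
  apply h2.mono_of_mem_nhdsWithin
  rw [← Ici_inter_Iic]
  exact Filter.inter_mem self_mem_nhdsWithin (mem_nhdsWithin_of_mem_nhds (Iic_mem_nhds (by linarith)))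

lemma LocDom.hasSum_J [CompleteSpace Y] {F : ℕ × ℕ → ℝ → Y} (h : LocDom F) {a t : ℝ} (ha : 0 < a)
    (ht : 0 ≤ t) : HasSum (fun p => J a (F p) t) (J a (fun s => ∑' p, F p s) t) := by
  obtain ⟨u, hu, hb⟩ := h.2 (t + 1) (by linarith)
  unfold J
  apply HasSum.const_smul
  apply intervalIntegral.hasSum_integral_of_dominated_convergence
    (fun p s => (t - s) ^ (a - 1) * u p)
  · intro p
    rw [uIoc_of_le ht]
    exact (J_integrable (h.1 p) ha ht).1.aestronglyMeasurable
  · intro p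
    refine Filter.Eventually.of_forall fun s hs => ?_
    rw [uIoc_of_le ht] at hs
    rw [norm_smul, Real.norm_of_nonneg (Real.rpow_nonneg (by linarith [hs.2]) _)]
    exact mul_le_mul_of_nonneg_left (hb p s ⟨hs.1.le, by linarith [hs.2]⟩)
        (Real.rpow_nonneg (by linarith [hs.2]) _)
  · exact Filter.Eventually.of_forall fun s hs => hu.mul_left _
  · simp only [tsum_mul_left]
    exact (ker_integrable a t ha).mul_const _
  · refine Filter.Eventually.of_forall fun s hs => ?_
    rw [uIoc_of_le ht] at hs
    exact (h.summable hs.1.le).hasSum.const_smul _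

/-- The terms of the series. -/
noncomputable def Fser (A B : Y →L[ℝ] Y) (δ α μ : ℝ) (f : ℝ → Y) (p : ℕ × ℕ) (t : ℝ) : Y :=
  J ((p.1 : ℝ) * δ + (p.2 : ℝ) * α + μ) (fun s => Q A B p.1 p.2 (f s)) t

lemma Fser_dom (A B : Y →L[ℝ] Y) {δ α μ : ℝ} (hδ : 0 < δ) (hα : δ ≤ α) (hμ : 0 < μ)
    {f : ℝ → Y} (hf : ContinuousOn f (Ici 0)) : LocDom (Fser A B δ α μ f) := by
  have hα0 : 0 ≤ α := by linarith
  have hpos : ∀ p : ℕ × ℕ, 0 < (p.1 : ℝ) * δ + (p.2 : ℝ) * α + μ := fun p => by positivity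
  constructor
  · intro p
    exact J_cont ((Q A B p.1 p.2).continuous.comp_continuousOn hf) (hpos p)
  · intro T hT
    obtain ⟨M, hM⟩ := (isCompact_Icc (a := (0:ℝ)) (b := T)).exists_bound_of_continuousOn
      (hf.mono Icc_subset_Ici_self)
    have hM0 : 0 ≤ M := (norm_nonneg _).trans (hM 0 ⟨le_rfl, hT.le⟩)
    refine ⟨_, (series_summable δ α μ T (‖A‖ + ‖B‖ + 1) hδ hα hμ.le hT
      (by linarith [norm_nonneg A, norm_nonneg B])).mul_right M, ?_⟩
    intro p t ht
    have h1 := J_norm_le (f := fun s => Q A B p.1 p.2 (f s)) (t := t)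
      (M := (‖A‖ + ‖B‖ + 1) ^ (p.1 + p.2) * M) (hpos p) ht.1 (fun s hs => by
        refine ((Q A B p.1 p.2).le_opNorm _).trans ?_
        have := Q_norm A B _ p.1 p.2 rfl
        have := hM s ⟨hs.1, hs.2.trans ht.2⟩
        gcongr)
    refine h1.trans ?_
    rw [mul_assoc]
    have := Real.Gamma_pos_of_pos (add_pos (hpos p) one_pos)
    have := ht.1
    have := ht.2
    have := (hpos p).le
    gcongr

lemma Fser_eq [CompleteSpace Y] (A B : Y →L[ℝ] Y) {δ α μ : ℝ} (hδ : 0 < δ) (hα : δ ≤ α)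
    (hμ : 0 < μ) {f : ℝ → Y} (hf : ContinuousOn f (Ici 0)) {t : ℝ} (ht : 0 ≤ t) :
    ∑' p, Fser A B δ α μ f p t = J μ f t + A (J δ (fun s => ∑' p, Fser A B δ α μ f p s) t)
      + B (J α (fun s => ∑' p, Fser A B δ α μ f p s) t) := by
  have hα0 : 0 < α := by linarith
  have hpos : ∀ p : ℕ × ℕ, 0 < (p.1 : ℝ) * δ + (p.2 : ℝ) * α + μ := fun p => by positivity
  have hdom := Fser_dom A B hδ hα hμ hf
  have hQf : ∀ U : Y →L[ℝ] Y, ContinuousOn (fun s => U (f s)) (Ici 0) :=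
    fun U => U.continuous.comp_continuousOn hf
  have key : ∀ (U : Y →L[ℝ] Y) (a : ℝ), 0 < a → HasSum (fun p : ℕ × ℕ =>
      J ((p.1 : ℝ) * δ + (p.2 : ℝ) * α + μ + a) (fun s => (U * Q A B p.1 p.2) (f s)) t)
      (U (J a (fun s => ∑' p, Fser A B δ α μ f p s) t)) := by
    intro U a ha
    have h1 := (hdom.hasSum_J ha ht).mapL U
    refine h1.congr_fun ?_
    intro p
    show _ = U (J a (Fser A B δ α μ f p) t)
    rw [add_comm _ a, ← J_semigroup (f := fun s => (U * Q A B p.1 p.2) (f s))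
      (hQf (U * Q A B p.1 p.2)) ha (hpos p) ht, ← J_clm U (hdom.1 p) ha ht]
    apply J_congr ht
    intro s hs
    exact (J_clm U (hQf _) (hpos p) hs)
  let Q0 : ℕ × ℕ → (Y →L[ℝ] Y) := fun p => if p = (0, 0) then 1 else 0
  let Q1 : ℕ × ℕ → (Y →L[ℝ] Y) := fun p => match p with
    | (0, _) => 0
    | (k + 1, m) => A * Q A B k m
  let Q2 : ℕ × ℕ → (Y →L[ℝ] Y) := fun p => match p with
    | (_, 0) => 0
    | (k, m + 1) => B * Q A B k m
  have hQ : ∀ p : ℕ × ℕ, Q A B p.1 p.2 = Q0 p + Q1 p + Q2 p := by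
    rintro ⟨k, m⟩
    match k, m with
    | 0, 0 => simp [Q0, Q1, Q2, Q]
    | k + 1, 0 => simp [Q0, Q1, Q2, Q_succ_zero]
    | 0, m + 1 => simp [Q0, Q1, Q2, Q_zero_succ]
    | k + 1, m + 1 => simp [Q0, Q1, Q2, Q_succ_succ]
  let G : (ℕ × ℕ → (Y →L[ℝ] Y)) → ℕ × ℕ → Y := fun R p =>
    J ((p.1 : ℝ) * δ + (p.2 : ℝ) * α + μ) (fun s => R p (f s)) t
  have hJ0 : ∀ a : ℝ, J a (fun _ => (0 : Y)) t = 0 := fun a => by simp [J]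
  have hG0 : HasSum (G Q0) (J μ f t) := by
    have h := hasSum_single (f := G Q0) (0, 0) (fun p hp => by simp [G, Q0, hp, hJ0])
    simpa [G, Q0] using h
  have hG1 : HasSum (G Q1) (A (J δ (fun s => ∑' p, Fser A B δ α μ f p s) t)) := by
    have hinj : Function.Injective (fun p : ℕ × ℕ => (p.1 + 1, p.2)) := by
      rintro ⟨a, b⟩ ⟨c, d⟩ h
      simpa using h
    rw [← hinj.hasSum_iff]
    · refine (key A δ hδ).congr_fun ?_
      rintro ⟨k, m⟩
      simp only [G, Q1, Function.comp]
      congr 1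
      push_cast; ring
    · rintro ⟨k, m⟩ h
      match k with
      | 0 => simp [G, Q1, hJ0]
      | k + 1 => exact absurd ⟨(k, m), rfl⟩ h
  have hG2 : HasSum (G Q2) (B (J α (fun s => ∑' p, Fser A B δ α μ f p s) t)) := by
    have hinj : Function.Injective (fun p : ℕ × ℕ => (p.1, p.2 + 1)) := by
      rintro ⟨a, b⟩ ⟨c, d⟩ h
      simpa using h
    rw [← hinj.hasSum_iff]
    · refine (key B α hα0).congr_fun ?_
      rintro ⟨k, m⟩
      simp only [G, Q2, Function.comp]
      congr 1
      push_cast; ring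
    · rintro ⟨k, m⟩ h
      match m with
      | 0 => simp [G, Q2, hJ0]
      | m + 1 => exact absurd ⟨(k, m), rfl⟩ h
  have htot := (hG0.add hG1).add hG2
  rw [← htot.tsum_eq]
  congr 1
  ext p
  simp only [Fser, G]
  have h01 : ContinuousOn (fun s => Q0 p (f s) + Q1 p (f s)) (Ici 0) := (hQf _).add (hQf _)
  rw [← J_add (hQf _) (hQf _) (hpos p) ht, ← J_add h01 (hQf _) (hpos p) ht]
  simp only [hQ p, ContinuousLinearMap.add_apply]

lemma frac_iter [CompleteSpace Y] (A : Y →L[ℝ] Y) {α β δ : ℝ} (hα1 : 1 < α) (hβ0 : 0 < β)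
    (hβ1 : β < 1) (hδ : 0 < δ) (v : Y) {y c : ℝ → Y}
    (hy : ContinuousOn y (Ici 0)) (hc : ContinuousOn c (Ici 0))
    (heq : ∀ t, 0 ≤ t → y t = J 1 (fun _ => v) t + J α c t + A (J δ y t)) :
    ∃ z : ℝ → Y, ContinuousOn z (Ici 0) ∧ ∀ t, 0 ≤ t → y t = J β z t := by
  obtain ⟨N, hN⟩ := exists_nat_gt (β / δ)
  set d := β / (N + 1) with hd
  have hd0 : 0 < d := by positivity
  have hNpos : (0:ℝ) < N + 1 := by positivity
  have hdδ : d < δ := by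
    rw [hd, div_lt_iff₀ hNpos]
    rw [div_lt_iff₀ hδ] at hN
    nlinarith
  have step1 : ∀ μ : ℝ, 0 < μ → μ ≤ β → (∃ w : ℝ → Y, ContinuousOn w (Ici 0) ∧
      ∀ t, 0 ≤ t → J δ y t = J μ w t) →
      ∃ z : ℝ → Y, ContinuousOn z (Ici 0) ∧ ∀ t, 0 ≤ t → y t = J μ z t := by
    rintro μ hμ hμβ ⟨w, hw, hyw⟩
    have c1 : ContinuousOn (J (1 - μ) (fun _ => v)) (Ici 0) :=
      J_cont continuousOn_const (by linarith)
    have c2 : ContinuousOn (J (α - μ) c) (Ici 0) := J_cont hc (by linarith)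
    have c3 : ContinuousOn (fun s => A (w s)) (Ici 0) := A.continuous.comp_continuousOn hw
    have c12 : ContinuousOn (fun s => J (1 - μ) (fun _ => v) s + J (α - μ) c s) (Ici 0) := c1.add c2
    refine ⟨fun s => (J (1 - μ) (fun _ => v) s + J (α - μ) c s) + A (w s), (c1.add c2).add c3, ?_⟩
    intro t ht
    rw [heq t ht, J_add c12 c3 hμ ht, J_add c1 c2 hμ ht,
      J_semigroup continuousOn_const hμ (by linarith) ht, J_semigroup hc hμ (by linarith) ht,
      J_clm A hw hμ ht, hyw t ht, add_sub_cancel, add_sub_cancel]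
  have step2 : ∀ n : ℕ, ((n:ℝ) + 1) * d ≤ β → ∃ w : ℝ → Y, ContinuousOn w (Ici 0) ∧
      ∀ t, 0 ≤ t → J δ y t = J (((n:ℝ) + 1) * d) w t := by
    intro n
    induction n with
    | zero =>
      intro _
      refine ⟨J (δ - d) y, J_cont hy (by linarith), fun t ht => ?_⟩
      rw [J_semigroup hy (by simpa using hd0) (by linarith) ht]
      congr 1
      simp
    | succ n ih =>
      intro hn
      push_cast at hn
      obtain ⟨z, hz, hyz⟩ := step1 (((n:ℝ) + 1) * d) (by positivity) (by nlinarith)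
        (ih (by nlinarith))
      refine ⟨J (δ - d) z, J_cont hz (by linarith), fun t ht => ?_⟩
      rw [J_semigroup hz (by positivity) (by linarith) ht, J_congr ht hyz,
        J_semigroup hz hδ (by positivity) ht]
      congr 1
      push_cast; ring
  have hNd : ((N:ℝ) + 1) * d = β := by rw [hd]; field_simp
  have := step1 β hβ0 le_rfl (by
    have := step2 N hNd.le
    rwa [hNd] at this)
  exact this

lemma conv_bound (A B : Y →L[ℝ] Y) {δ α : ℝ} (hδ : 0 < δ) (hα1 : 1 < α) {v : Y} {M r T : ℝ}
    (hr : 0 ≤ r) (hrT : r ≤ T) (hv : ‖v‖ ≤ M) (p : ℕ × ℕ) :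
    ‖((r ^ ((p.1 : ℝ) * δ + (p.2 : ℝ) * α + α - 1)) /
            Real.Gamma ((p.1 : ℝ) * δ + (p.2 : ℝ) * α + α)) • (Q A B p.1 p.2) v‖ ≤
      T ^ ((p.1 : ℝ) * δ + (p.2 : ℝ) * α + (α - 1)) /
      Real.Gamma ((p.1 : ℝ) * δ + (p.2 : ℝ) * α + (α - 1) + 1) *
        (‖A‖ + ‖B‖ + 1) ^ (p.1 + p.2) * M := by
  have hα0 : 0 < α := by linarith
  have hp : 0 < (p.1 : ℝ) * δ + (p.2 : ℝ) * α + α := by positivity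
  have hp' : 0 ≤ (p.1 : ℝ) * δ + (p.2 : ℝ) * α + α - 1 := by
    have : 0 ≤ (p.1 : ℝ) * δ + (p.2 : ℝ) * α := by positivity
    linarith
  have hM0 : 0 ≤ M := (norm_nonneg _).trans hv
  rw [show (p.1 : ℝ) * δ + (p.2 : ℝ) * α + (α - 1) + 1 = (p.1 : ℝ) * δ + (p.2 : ℝ) * α + α by ring,
    ← add_sub_assoc]
  have hG := Real.Gamma_pos_of_pos hp
  have h1 : ‖(Q A B p.1 p.2) v‖ ≤ (‖A‖ + ‖B‖ + 1) ^ (p.1 + p.2) * M :=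
    ((Q A B p.1 p.2).le_opNorm _).trans
      (mul_le_mul (Q_norm A B _ p.1 p.2 rfl) hv (norm_nonneg _) (by positivity))
  have h2 : 0 ≤ r ^ ((p.1 : ℝ) * δ + (p.2 : ℝ) * α + α - 1) /
      Real.Gamma ((p.1 : ℝ) * δ + (p.2 : ℝ) * α + α) := by positivity
  rw [norm_smul, Real.norm_of_nonneg h2, mul_assoc]
  have h3 := Real.rpow_le_rpow hr hrT hp'
  exact mul_le_mul (div_le_div_of_nonneg_right h3 hG.le) h1 (norm_nonneg _)
    (h2.trans (div_le_div_of_nonneg_right h3 hG.le))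

lemma hasSum_int_const [CompleteSpace Y] {F : ℕ × ℕ → ℝ → Y} {u : ℕ × ℕ → ℝ} {t : ℝ} (ht : 0 ≤ t)
    (hF : ∀ p, IntervalIntegrable (F p) volume 0 t) (hu : Summable u)
    (hb : ∀ p, ∀ s ∈ Ioc 0 t, ‖F p s‖ ≤ u p) :
    ∫ s in (0:ℝ)..t, ∑' p, F p s = ∑' p, ∫ s in (0:ℝ)..t, F p s := by
  symm
  apply HasSum.tsum_eq
  apply intervalIntegral.hasSum_integral_of_dominated_convergence (fun p _ => u p)
  · intro p
    rw [uIoc_of_le ht]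
    exact (hF p).1.aestronglyMeasurable
  · intro p
    refine Filter.Eventually.of_forall fun s hs => ?_
    rw [uIoc_of_le ht] at hs
    exact hb p s hs
  · exact Filter.Eventually.of_forall fun s hs => hu
  · exact intervalIntegrable_const
  · refine Filter.Eventually.of_forall fun s hs => ?_
    rw [uIoc_of_le ht] at hs
    exact (Summable.of_norm_bounded hu fun p => hb p s hs).hasSum

lemma conv_eq [CompleteSpace Y] (A B : Y →L[ℝ] Y) {δ α : ℝ} (hδ : 0 < δ) (hα : δ ≤ α)
    (hα1 : 1 < α) {g : ℝ → Y} (hg : ContinuousOn g (Ici 0)) {t : ℝ} (ht : 0 ≤ t) :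
    ∫ s in (0:ℝ)..t, (∑' p : ℕ × ℕ, (((t - s) ^ ((p.1 : ℝ) * δ + (p.2 : ℝ) * α + α - 1)) /
            Real.Gamma ((p.1 : ℝ) * δ + (p.2 : ℝ) * α + α)) • (Q A B p.1 p.2) (g s))
      = ∑' p, Fser A B δ α α g p t := by
  have hα0 : 0 < α := by linarith
  have hpos : ∀ p : ℕ × ℕ, 0 < (p.1 : ℝ) * δ + (p.2 : ℝ) * α + α := fun p => by positivity
  obtain ⟨M, hM⟩ := (isCompact_Icc (a := (0:ℝ)) (b := t)).exists_bound_of_continuousOn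
    (hg.mono Icc_subset_Ici_self)
  have hsum := (series_summable δ α (α - 1) (t + 1) (‖A‖ + ‖B‖ + 1) hδ hα (by linarith)
    (by linarith) (by linarith [norm_nonneg A, norm_nonneg B])).mul_right M
  have e : ∀ p : ℕ × ℕ, (fun s => (((t - s) ^ ((p.1 : ℝ) * δ + (p.2 : ℝ) * α + α - 1)) /
      Real.Gamma ((p.1 : ℝ) * δ + (p.2 : ℝ) * α + α)) • (Q A B p.1 p.2) (g s)) =
      fun s => (Real.Gamma ((p.1 : ℝ) * δ + (p.2 : ℝ) * α + α))⁻¹ •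
        ((t - s) ^ ((p.1 : ℝ) * δ + (p.2 : ℝ) * α + α - 1)) • (Q A B p.1 p.2) (g s) := by
    intro p
    ext s
    rw [smul_smul, div_eq_inv_mul]
  rw [hasSum_int_const ht ?_ hsum ?_]
  · refine tsum_congr fun p => ?_
    rw [e p, intervalIntegral.integral_smul]
    rfl
  · intro p
    rw [e p]
    exact (J_integrable ((Q A B p.1 p.2).continuous.comp_continuousOn hg) (hpos p) ht).smul _
  · intro p s hs
    exact conv_bound A B hδ hα1 (by linarith [hs.2]) (by linarith [hs.1]) (hM s ⟨hs.1.le, hs.2⟩) p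

end aux

/-- The mild solution of the inhomogeneous multi-term fractional evolution equation with
nonpermutable operators satisfies `x(0) = η`, `x'(0) = η̂`, its Caputo derivatives of orders
`α ∈ (1,2)` and `β ∈ (0,1)` exist for `t > 0`, and
`(ᶜD^α x)(t) − A (ᶜD^β x)(t) = B x(t) + g(t)`. -/
theorem inhomogeneous_mild_solution {Y : Type*} [NormedAddCommGroup Y] [NormedSpace ℝ Y]
    [CompleteSpace Y] (A B : Y →L[ℝ] Y) (α β : ℝ)
    (hα1 : 1 < α) (hα2 : α < 2) (hβ0 : 0 < β) (hβ1 : β < 1) (η ηh : Y)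
    (g : ℝ → Y) (hg : ContinuousOn g (Set.Ici 0)) (x : ℝ → Y)
    (hx : ∀ t : ℝ, 0 ≤ t → x t = η
      + (∑' p : ℕ × ℕ, ((t ^ ((p.1 : ℝ) * (α - β) + (p.2 : ℝ) * α + α)) /
          Real.Gamma ((p.1 : ℝ) * (α - β) + (p.2 : ℝ) * α + α + 1)) • (Q A B p.1 p.2) (B η))
      + (∑' p : ℕ × ℕ, ((t ^ ((p.1 : ℝ) * (α - β) + (p.2 : ℝ) * α + 1)) /
          Real.Gamma ((p.1 : ℝ) * (α - β) + (p.2 : ℝ) * α + 2)) • (Q A B p.1 p.2) ηh)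
      + ∫ s in (0:ℝ)..t,
          (∑' p : ℕ × ℕ, (((t - s) ^ ((p.1 : ℝ) * (α - β) + (p.2 : ℝ) * α + α - 1)) /
            Real.Gamma ((p.1 : ℝ) * (α - β) + (p.2 : ℝ) * α + α)) • (Q A B p.1 p.2) (g s))) :
    x 0 = η ∧
    HasDerivWithinAt x ηh (Set.Ici 0) 0 ∧
    ∃ Iα' Dα Dβ : ℝ → Y,
      (∀ t : ℝ, 0 < t → HasDerivWithinAt
        (fun τ => (Real.Gamma (2 - α))⁻¹ •
          ∫ s in (0:ℝ)..τ, ((τ - s) ^ (1 - α)) • (x s - η - s • ηh))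
        (Iα' t) (Set.Ici 0) t) ∧
      (∀ t : ℝ, 0 < t → HasDerivWithinAt Iα' (Dα t) (Set.Ici 0) t) ∧
      (∀ t : ℝ, 0 < t → HasDerivWithinAt
        (fun τ => (Real.Gamma (1 - β))⁻¹ •
          ∫ s in (0:ℝ)..τ, ((τ - s) ^ (-β)) • (x s - η))
        (Dβ t) (Set.Ici 0) t) ∧
      (∀ t : ℝ, 0 < t → Dα t - A (Dβ t) = B (x t) + g t) := by
  have hδ : 0 < α - β := by linarith
  have hδα : α - β ≤ α := by linarith
  have hα0 : 0 < α := by linarith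
  have hpos : ∀ p : ℕ × ℕ, 0 ≤ (p.1 : ℝ) * (α - β) + (p.2 : ℝ) * α := fun p => by positivity
  have ch : ContinuousOn (fun s => B η + g s) (Set.Ici 0) := continuousOn_const.add hg
  have cc : ContinuousOn (fun _ : ℝ => ηh) (Set.Ici 0) := continuousOn_const
  have dB := Fser_dom A B hδ hδα hα0 (f := fun _ => B η) continuousOn_const
  have dg := Fser_dom A B hδ hδα hα0 hg
  have dh := Fser_dom A B hδ hδα hα0 ch
  have dc := Fser_dom A B hδ hδα one_pos cc
  obtain ⟨y, hydef⟩ : ∃ y : ℝ → Y, y = fun t => ∑' p, Fser A B (α - β) α α (fun s => B η + g s) p t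
      + ∑' p, Fser A B (α - β) α 1 (fun _ => ηh) p t := ⟨_, rfl⟩
  have hyc : ContinuousOn y (Set.Ici 0) := by rw [hydef]; exact dh.cont.add dc.cont
  have hxy : ∀ t, 0 ≤ t → x t = η + y t := by
    intro t ht
    rw [hx t ht, conv_eq A B hδ hδα hα1 hg ht, hydef]
    have e1 : ∀ p : ℕ × ℕ, Fser A B (α - β) α α (fun s => B η + g s) p t =
        ((t ^ ((p.1 : ℝ) * (α - β) + (p.2 : ℝ) * α + α)) /
          Real.Gamma ((p.1 : ℝ) * (α - β) + (p.2 : ℝ) * α + α + 1)) • (Q A B p.1 p.2) (B η)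
        + Fser A B (α - β) α α g p t := by
      intro p
      have hp : 0 < (p.1 : ℝ) * (α - β) + (p.2 : ℝ) * α + α := by linarith [hpos p]
      have hQg : ContinuousOn (fun s => Q A B p.1 p.2 (g s)) (Set.Ici 0) :=
        (Q A B p.1 p.2).continuous.comp_continuousOn hg
      unfold Fser
      rw [← J_const _ hp, ← J_add continuousOn_const hQg hp ht]
      simp only [map_add]
    have e2 : ∀ p : ℕ × ℕ, Fser A B (α - β) α 1 (fun _ => ηh) p t =
        ((t ^ ((p.1 : ℝ) * (α - β) + (p.2 : ℝ) * α + 1)) /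
          Real.Gamma ((p.1 : ℝ) * (α - β) + (p.2 : ℝ) * α + 2)) • (Q A B p.1 p.2) ηh := by
      intro p
      unfold Fser
      rw [J_const _ (by linarith [hpos p]), add_assoc _ (1:ℝ) 1, one_add_one_eq_two]
    have e3 : Summable fun p : ℕ × ℕ => ((t ^ ((p.1 : ℝ) * (α - β) + (p.2 : ℝ) * α + α)) /
          Real.Gamma ((p.1 : ℝ) * (α - β) + (p.2 : ℝ) * α + α + 1)) • (Q A B p.1 p.2) (B η) := by
      refine (dB.summable ht).congr fun p => ?_
      unfold Fser
      rw [J_const _ (by linarith [hpos p])]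
    simp only [e1, e2]
    rw [e3.tsum_add (dg.summable ht)]
    abel
  have hBy : ContinuousOn (fun s => B (y s)) (Set.Ici 0) := B.continuous.comp_continuousOn hyc
  obtain ⟨c, hcdef⟩ : ∃ c : ℝ → Y, c = fun s => (B η + g s) + B (y s) := ⟨_, rfl⟩
  have hcc : ContinuousOn c (Set.Ici 0) := by rw [hcdef]; exact ch.add hBy
  have heq : ∀ t, 0 ≤ t → y t = J 1 (fun _ => ηh) t + J α c t + A (J (α - β) y t) := by
    intro t ht
    have h1 := Fser_eq A B hδ hδα hα0 ch ht
    have h2 := Fser_eq A B hδ hδα one_pos cc ht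
    rw [hcdef, J_add ch hBy hα0 ht, J_clm B hyc hα0 ht, hydef, J_add dh.cont dc.cont hδ ht,
      J_add dh.cont dc.cont hα0 ht, map_add, map_add]
    simp only
    rw [h1, h2]
    abel
  obtain ⟨z, hz, hyz⟩ := frac_iter A hα1 hβ0 hβ1 hδ ηh hyc hcc heq
  have hAz : ContinuousOn (fun s => A (z s)) (Set.Ici 0) := A.continuous.comp_continuousOn hz
  obtain ⟨w, hwdef⟩ : ∃ w : ℝ → Y, w = fun s => c s + A (z s) := ⟨_, rfl⟩
  have hw : ContinuousOn w (Set.Ici 0) := by rw [hwdef]; exact hcc.add hAz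
  have hyw : ∀ t, 0 ≤ t → y t = J 1 (fun _ => ηh) t + J α w t := by
    intro t ht
    rw [heq t ht, hwdef, J_add hcc hAz hα0 ht, J_clm A hz hα0 ht, J_congr ht hyz,
      J_semigroup hz hδ hβ0 ht, sub_add_cancel, add_assoc]
  have hJ1 : ∀ t, J 1 (fun _ => ηh) t = t • ηh := by
    intro t
    rw [J_one]; simp
  have hw1 : ContinuousOn (J (α - 1) w) (Set.Ici 0) := J_cont hw (by linarith)
  have hy1 : ∀ t, 0 ≤ t → y t = J 1 (fun s => ηh + J (α - 1) w s) t := by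
    intro t ht
    rw [J_add cc hw1 one_pos ht, J_semigroup hw one_pos (by linarith) ht, add_sub_cancel, hyw t ht]
  have hx0 : x 0 = η := by
    rw [hxy 0 le_rfl, hy1 0 le_rfl]; simp [J]
  refine ⟨hx0, ?_, J 1 w, w, z, ?_, ?_, ?_, ?_⟩
  · have h := (J_one_deriv (cc.add hw1) (le_refl (0:ℝ))).const_add η
    have e : ηh + J (α - 1) w 0 = ηh := by simp [J]
    rw [show ((fun _ => ηh) + J (α - 1) w : ℝ → Y) 0 = ηh from e] at h
    refine h.congr_of_mem (fun s hs => ?_) Set.self_mem_Ici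
    rw [hxy s hs, hy1 s hs]
    rfl
  · intro t ht
    have h := J_one_deriv (J_cont hw one_pos) ht.le
    refine h.congr_of_mem (fun s hs => ?_) (Set.mem_Ici.2 ht.le)
    have hs : 0 ≤ s := hs
    have h2 : J (2 - α) (J α w) s = J 1 (J 1 w) s := by
      rw [J_semigroup hw (by linarith) hα0 hs, J_semigroup hw one_pos one_pos hs]
      congr 1; ring
    rw [← h2, J_congr (g := fun s => x s - η - s • ηh) hs (fun r hr => by
      rw [hxy r hr, hyw r hr, hJ1]; abel)]
    unfold J
    rw [show 2 - α - 1 = 1 - α by ring]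
  · intro t ht
    exact J_one_deriv hw ht.le
  · intro t ht
    have h := J_one_deriv hz ht.le
    refine h.congr_of_mem (fun s hs => ?_) (Set.mem_Ici.2 ht.le)
    have hs : 0 ≤ s := hs
    have h2 : J (1 - β) (J β z) s = J 1 z s := by
      rw [J_semigroup hz (by linarith) hβ0 hs]
      congr 1; ring
    rw [← h2, J_congr (g := fun s => x s - η) hs (fun r hr => by
      rw [hxy r hr, hyz r hr]; abel)]
    unfold J
    rw [show 1 - β - 1 = -β by ring]
  · intro t ht
    rw [hwdef, hcdef, hxy t ht.le, map_add]
    simp only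
    abel
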